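/- arXiv:0809.4173 — 2 statements merged into one kernel-verified Lean document; each statement's English description precedes it below -/
import Mathlib

section
/- The operators T_k satisfy the braid relations: T_k T_j = T_j T_k whenever |k − j| > 1, and T_k T_{k+1} T_k = T_{k+1} T_k T_{k+1} for all 1 ≤ k ≤ n−2. Consequently, the assignment τ_k ↦ T_k extends to a group homomorphism (representation) φ : B_n → Aut(V). -/
/-- The set of all `n`-tuples obtained by permuting the coordinates of `z`. -/
def Xset (n : ℕ) (z : Fin n → ℕ) : Set (Fin n → ℕ) :=
  Set.range fun π : Equiv.Perm (Fin n) => z ∘ ⇑π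

/-- The map induced on `Xset n z` by swapping coordinates `k` and `k+1` (0-indexed, so `k`
corresponds to the paper's index `k+1`). -/
def sigmaX {n : ℕ} {z : Fin n → ℕ} (k : ℕ) (hk : k + 1 < n) (x : ↥(Xset n z)) :
    ↥(Xset n z) :=
  ⟨x.1 ∘ ⇑(Equiv.swap ⟨k, Nat.lt_of_succ_lt hk⟩ ⟨k + 1, hk⟩), by
    obtain ⟨π, hπ⟩ := x.2
    exact ⟨(Equiv.swap ⟨k, Nat.lt_of_succ_lt hk⟩ ⟨k + 1, hk⟩).trans π, by rw [← hπ]; rfl⟩⟩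

/-- The braid relations on `n-1` generators `τ_0, …, τ_{n-2}` (0-indexed):
`τ_iτ_j = τ_jτ_i` for `|i-j| > 1` and `τ_iτ_{i+1}τ_i = τ_{i+1}τ_iτ_{i+1}`. -/
def braidRels (n : ℕ) : Set (FreeGroup (Fin (n - 1))) :=
  {r | (∃ i j : Fin (n - 1), (i.val + 1 < j.val ∨ j.val + 1 < i.val) ∧
          r = FreeGroup.of i * FreeGroup.of j * (FreeGroup.of i)⁻¹ * (FreeGroup.of j)⁻¹) ∨
       (∃ i j : Fin (n - 1), j.val = i.val + 1 ∧
          r = FreeGroup.of i * FreeGroup.of j * FreeGroup.of i *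
              (FreeGroup.of j * FreeGroup.of i * FreeGroup.of j)⁻¹)}

theorem sigmaX_apply {n : ℕ} {z : Fin n → ℕ} (k : ℕ) (hk : k + 1 < n) (x : ↥(Xset n z))
    (i : Fin n) :
    (sigmaX k hk x).1 i =
      if i.val = k then x.1 ⟨k + 1, hk⟩
      else if i.val = k + 1 then x.1 ⟨k, Nat.lt_of_succ_lt hk⟩ else x.1 i := by
  simp only [sigmaX, Function.comp_apply, Equiv.swap_apply_def, Fin.ext_iff]
  split_ifs <;> rfl

theorem sigmaX_comm {n : ℕ} {z : Fin n → ℕ} (j k : ℕ) (hj : j + 1 < n) (hk : k + 1 < n)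
    (hjk : j + 1 < k ∨ k + 1 < j) (x : ↥(Xset n z)) :
    sigmaX k hk (sigmaX j hj x) = sigmaX j hj (sigmaX k hk x) := by
  ext i
  simp only [sigmaX_apply]
  grind

theorem sigmaX_braid {n : ℕ} {z : Fin n → ℕ} (k : ℕ) (hk : k + 2 < n) (x : ↥(Xset n z)) :
    sigmaX k (Nat.lt_of_succ_lt hk) (sigmaX (k + 1) hk (sigmaX k (Nat.lt_of_succ_lt hk) x)) =
      sigmaX (k + 1) hk (sigmaX k (Nat.lt_of_succ_lt hk) (sigmaX (k + 1) hk x)) := by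
  ext i
  simp only [sigmaX_apply]
  grind

/-- The operators `T_k` satisfy the braid relations, and consequently
`τ_k ↦ T_k` extends to a group homomorphism from the braid group `B_n` (presented by the
braid relations) to `Aut(V)`. -/
theorem braid_representation (n : ℕ) (hn : 3 ≤ n) (z : Fin n → ℕ)
    (V : Type) [NormedAddCommGroup V] [InnerProductSpace ℂ V]
    (b : Module.Basis ↥(Xset n z) ℂ V) (hb : Orthonormal ℂ ⇑b)
    (q : ℕ → ℕ → ℂ) (hq : ∀ a c : ℕ, q a c ≠ 0)
    (T : (k : ℕ) → k + 1 < n → (V ≃ₗ[ℂ] V))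
    (hT : ∀ (k : ℕ) (hk : k + 1 < n) (x : ↥(Xset n z)),
      T k hk (b x) =
        q (x.1 ⟨k, Nat.lt_of_succ_lt hk⟩) (x.1 ⟨k + 1, hk⟩) • b (sigmaX k hk x)) :
    (∀ (j k : ℕ) (hj : j + 1 < n) (hk : k + 1 < n), (j + 1 < k ∨ k + 1 < j) →
        T k hk * T j hj = T j hj * T k hk) ∧
    (∀ (k : ℕ) (hk : k + 2 < n),
        T k (Nat.lt_of_succ_lt hk) * T (k + 1) hk * T k (Nat.lt_of_succ_lt hk) =
          T (k + 1) hk * T k (Nat.lt_of_succ_lt hk) * T (k + 1) hk) ∧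
    (∃ φ : PresentedGroup (braidRels n) →* (V ≃ₗ[ℂ] V),
        ∀ k : Fin (n - 1), φ (PresentedGroup.of k) =
          T k.val (Nat.add_lt_of_lt_sub k.isLt)) := by
  have hcomm : ∀ (j k : ℕ) (hj : j + 1 < n) (hk : k + 1 < n), (j + 1 < k ∨ k + 1 < j) →
      T k hk * T j hj = T j hj * T k hk := by
    intro j k hj hk hjk
    refine b.ext' fun x => ?_
    have h₁ : j ≠ k := by omega
    have h₂ : k + 1 ≠ j := by omega
    have h₃ : j + 1 ≠ k := by omega
    simp only [LinearEquiv.mul_apply, hT, map_smul, smul_smul, sigmaX_comm j k hj hk hjk]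
    simp [sigmaX_apply, h₁, h₁.symm, h₂, h₂.symm, h₃, h₃.symm, mul_comm]
  have hbraid : ∀ (k : ℕ) (hk : k + 2 < n),
      T k (Nat.lt_of_succ_lt hk) * T (k + 1) hk * T k (Nat.lt_of_succ_lt hk) =
        T (k + 1) hk * T k (Nat.lt_of_succ_lt hk) * T (k + 1) hk := by
    intro k hk
    refine b.ext' fun x => ?_
    simp only [LinearEquiv.mul_apply, hT, map_smul, smul_smul, sigmaX_braid k hk]
    congr 1
    simp [sigmaX_apply, add_assoc]
    ring
  refine ⟨hcomm, hbraid, PresentedGroup.toGroup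
    (f := fun k : Fin (n - 1) => T k.val (Nat.add_lt_of_lt_sub k.isLt)) ?_,
    fun k => PresentedGroup.toGroup.of _⟩
  rintro r (⟨i, j, hij, rfl⟩ | ⟨⟨i, hi⟩, ⟨j, hj⟩, hij, rfl⟩)
  · simp only [map_mul, map_inv, FreeGroup.lift_apply_of]
    rw [hcomm j i _ _ hij.symm]
    group
  · obtain rfl : j = i + 1 := hij
    simp only [map_mul, map_inv, FreeGroup.lift_apply_of]
    rw [mul_inv_eq_one]
    exact hbraid i _
end

section
/- If each operator T_k (1 ≤ k ≤ n−1) is self-adjoint, and for every pair of distinct x, y ∈ X there exists j with 1 ≤ j ≤ n−1 such that |q_{x_j,x_{j+1}}|² ≠ |q_{y_j,y_{j+1}}|², then the representation φ of B_n defined by φ(τ_k) = T_k is irreducible (i.e., the only φ-invariant subspaces of V are 0 and V). -/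
/-- If a family of operators is diagonal in a basis with eigenvalues separating the basis vectors,
then a subspace invariant under the family contains every basis vector on which one of its elements
has a nonzero coordinate. -/
theorem Submodule.basis_mem_of_separating_diagonal {K V ι J : Type*} [Field K] [AddCommGroup V]
    [Module K V] [Finite ι] (b : Module.Basis ι K V) (D : J → V →ₗ[K] V) (l : J → ι → K)
    (hD : ∀ j i, D j (b i) = l j i • b i)
    (hl : ∀ x y, x ≠ y → ∃ j, l j x ≠ l j y)
    (W : Submodule K V) (hW : ∀ j, ∀ w ∈ W, D j w ∈ W)
    {w : V} (hw : w ∈ W) {x : ι} (hx : b.repr w x ≠ 0) : b x ∈ W := by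
  classical
  have := Fintype.ofFinite ι
  have hrepr : ∀ j v i, b.repr (D j v) i = l j i * b.repr v i := by
    intro j v i
    have h : (b.coord i).comp (D j) = l j i • b.coord i := by
      refine b.ext fun k => ?_
      by_cases hk : k = i
      · subst hk
        simp [hD]
      · simp [hD, hk]
    simpa using LinearMap.congr_fun h v
  have key : ∀ S : Finset ι, x ∉ S →
      ∃ v ∈ W, b.repr v x ≠ 0 ∧ ∀ i ∈ S, b.repr v i = 0 := by
    intro S
    induction S using Finset.induction_on with
    | empty => exact fun _ => ⟨w, hw, hx, by simp⟩
    | insert y S _ ih =>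
      intro hxS
      rw [Finset.mem_insert, not_or] at hxS
      obtain ⟨v, hv, hvx, hvS⟩ := ih hxS.2
      obtain ⟨j, hj⟩ := hl x y hxS.1
      have hc : ∀ i, b.repr (D j v - l j y • v) i = (l j i - l j y) * b.repr v i := by
        intro i
        simp [hrepr, sub_mul]
      refine ⟨D j v - l j y • v, W.sub_mem (hW j v hv) (W.smul_mem _ hv), ?_, ?_⟩
      · rw [hc]
        exact mul_ne_zero (sub_ne_zero.2 hj) hvx
      · intro i hi
        rw [hc]
        rcases Finset.mem_insert.1 hi with rfl | hi
        · simp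
        · simp [hvS i hi]
  obtain ⟨v, hv, hvx, hvS⟩ := key (Finset.univ.erase x) (by simp)
  have hvb : v = b.repr v x • b x := by
    conv_lhs => rw [← b.sum_repr v]
    refine Finset.sum_eq_single x (fun i _ hi => ?_) (by simp)
    rw [hvS i (by simp [hi]), zero_smul]
  rw [hvb] at hv
  exact (W.smul_mem_iff hvx).1 hv

/-- A property of tuples stable under adjacent transpositions holds for all rearrangements. -/
theorem Xset.of_sigmaX {n : ℕ} {z : Fin n → ℕ} (P : Xset n z → Prop)
    (hP : ∀ (k : ℕ) (hk : k + 1 < n) (x : Xset n z), P x → P (sigmaX k hk x))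
    {x : Xset n z} (hx : P x) (y : Xset n z) : P y := by
  cases n with
  | zero =>
    have : x = y := Subsingleton.elim _ _
    exact this ▸ hx
  | succ m =>
    have key : ∀ π : Equiv.Perm (Fin (m + 1)), ∀ x y : Xset (m + 1) z,
        y.1 = x.1 ∘ π → P x → P y := by
      intro π
      have hπ : π ∈ Submonoid.closure
          (Set.range fun i : Fin m => Equiv.swap i.castSucc i.succ) := by
        rw [Equiv.Perm.mclosure_swap_castSucc_succ]
        trivial
      induction hπ using Submonoid.closure_induction with
      | mem π h =>
        obtain ⟨i, rfl⟩ := h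
        intro x y hy hx
        have : y = sigmaX i.1 (by omega) x := Subtype.ext hy
        exact this ▸ hP _ _ x hx
      | one =>
        intro x y hy hx
        have : y = x := Subtype.ext hy
        exact this ▸ hx
      | mul π ρ _ _ ihπ ihρ =>
        intro x y hy hx
        obtain ⟨τ, hτ⟩ := x.2
        refine ihρ ⟨x.1 ∘ π, π.trans τ, ?_⟩ y hy (ihπ x _ rfl hx)
        rw [← hτ]
        rfl
    obtain ⟨π, hπ⟩ := x.2
    obtain ⟨ρ, hρ⟩ := y.2
    refine key (ρ.trans π.symm) x y ?_ hx
    rw [← hπ, ← hρ]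
    ext i
    simp

theorem sigmaX_sigmaX {n : ℕ} {z : Fin n → ℕ} (k : ℕ) (hk : k + 1 < n) (x : Xset n z) :
    sigmaX k hk (sigmaX k hk x) = x := by
  ext i
  simp [sigmaX]

/-- If every `T_k` is self-adjoint and for every pair of distinct `x, y ∈ X`
there is a `j` with `|q_{x_j,x_{j+1}}|² ≠ |q_{y_j,y_{j+1}}|²`, then the representation of
`B_n` with `φ(τ_k) = T_k` is irreducible: the only subspaces invariant under all the `T_k`
are `0` and `V`. -/
theorem braid_irreducible (n : ℕ) (hn : 3 ≤ n) (z : Fin n → ℕ)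
    (V : Type) [NormedAddCommGroup V] [InnerProductSpace ℂ V] [FiniteDimensional ℂ V]
    (b : Module.Basis ↥(Xset n z) ℂ V) (hb : Orthonormal ℂ ⇑b)
    (q : ℕ → ℕ → ℂ) (hq : ∀ a c : ℕ, q a c ≠ 0)
    (T : (k : ℕ) → k + 1 < n → (V ≃ₗ[ℂ] V))
    (hT : ∀ (k : ℕ) (hk : k + 1 < n) (x : ↥(Xset n z)),
      T k hk (b x) =
        q (x.1 ⟨k, Nat.lt_of_succ_lt hk⟩) (x.1 ⟨k + 1, hk⟩) • b (sigmaX k hk x))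
    (hsa : ∀ (k : ℕ) (hk : k + 1 < n),
      LinearMap.adjoint (T k hk : V →ₗ[ℂ] V) = (T k hk : V →ₗ[ℂ] V))
    (hsep : ∀ x y : ↥(Xset n z), x ≠ y →
      ∃ (j : ℕ) (hj : j + 1 < n),
        Complex.normSq (q (x.1 ⟨j, Nat.lt_of_succ_lt hj⟩) (x.1 ⟨j + 1, hj⟩)) ≠
          Complex.normSq (q (y.1 ⟨j, Nat.lt_of_succ_lt hj⟩) (y.1 ⟨j + 1, hj⟩))) :
    ∀ W : Submodule ℂ V,
      (∀ (k : ℕ) (hk : k + 1 < n), ∀ w ∈ W, T k hk w ∈ W) → W = ⊥ ∨ W = ⊤ := by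
  intro W hW
  have : Finite (Xset n z) := Set.finite_range _
  have hsq : ∀ (k : ℕ) (hk : k + 1 < n) (x : Xset n z), T k hk (T k hk (b x)) =
      (Complex.normSq (q (x.1 ⟨k, Nat.lt_of_succ_lt hk⟩) (x.1 ⟨k + 1, hk⟩)) : ℂ) • b x := by
    intro k hk x
    have h := LinearMap.adjoint_inner_left (T k hk : V →ₗ[ℂ] V) (b (sigmaX k hk x)) (b x)
    have h1 : ∀ y, inner ℂ (b y) (b y) = (1 : ℂ) := fun y => by
      rw [inner_self_eq_norm_sq_to_K, hb.1 y]
      simp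
    rw [hsa, LinearEquiv.coe_coe, hT, hT, sigmaX_sigmaX, inner_smul_left, inner_smul_right,
      h1, h1, mul_one, mul_one] at h
    rw [hT, map_smul, hT, sigmaX_sigmaX, smul_smul, ← h, Complex.mul_conj]
  refine or_iff_not_imp_left.2 fun hne => ?_
  obtain ⟨w, hw, hw0⟩ := W.ne_bot_iff.1 hne
  obtain ⟨x, hx⟩ : ∃ x, b.repr w x ≠ 0 := by
    by_contra! h
    exact hw0 (b.repr.map_eq_zero_iff.1 (Finsupp.ext h))
  have hbx : b x ∈ W := by
    refine W.basis_mem_of_separating_diagonal b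
      (fun j : {k : ℕ // k + 1 < n} => (T j.1 j.2 : V →ₗ[ℂ] V) ∘ₗ (T j.1 j.2 : V →ₗ[ℂ] V))
      (fun j x => (Complex.normSq
        (q (x.1 ⟨j.1, Nat.lt_of_succ_lt j.2⟩) (x.1 ⟨j.1 + 1, j.2⟩)) : ℂ))
      (fun j x => hsq j.1 j.2 x) (fun x y hxy => ?_)
      (fun j w hw => hW _ _ _ (hW _ _ _ hw)) hw hx
    obtain ⟨j, hj, h⟩ := hsep x y hxy
    exact ⟨⟨j, hj⟩, fun h' => h (Complex.ofReal_injective h')⟩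
  rw [eq_top_iff, ← b.span_eq, Submodule.span_le]
  rintro _ ⟨y, rfl⟩
  refine Xset.of_sigmaX (fun y => b y ∈ W) (fun k hk y hy => ?_) hbx y
  have h := hW k hk _ hy
  rw [hT] at h
  exact (W.smul_mem_iff (hq _ _)).1 h
end
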